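/- arXiv:1504.07257 — 2 statements merged into one kernel-verified Lean document; each statement's English description precedes it below -/
import Mathlib

section
/- Let R be a ring, 'C = 'C_R, a = ass_R('C), R̄ = R/a and 'C̄ = {c + a | c ∈ 'C}. The following are equivalent: (1) 'C is a left denominator set of R and 'Q_{l,cl}(R) := 'C⁻¹R is a semisimple Artinian ring; (2) there exist left denominator sets S_1, …, S_n of the ring R such that (a) each ring S_i⁻¹R is a simple Artinian ring, (b) a = ⋂_{i=1}^n ass_R(S_i), and (c) 'C̄ is a dense subset of C_{R̄}. -/
universe u

namespace Bavula

/-- The set of left regular elements of `R`. -/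
def lReg (R : Type u) [Ring R] : Set R := {c : R | ∀ x : R, x * c = 0 → x = 0}

/-- The set of right regular elements of `R`. -/
def rReg (R : Type u) [Ring R] : Set R := {c : R | ∀ x : R, c * x = 0 → x = 0}

/-- The set of regular elements of `R`. -/
def reg (R : Type u) [Ring R] : Set R := lReg R ∩ rReg R

/-- `S` is a multiplicative set of `R`. -/
def IsMulSet {R : Type u} [Ring R] (S : Set R) : Prop :=
  (1 : R) ∈ S ∧ (∀ a ∈ S, ∀ b ∈ S, a * b ∈ S) ∧ (0 : R) ∉ S

/-- `S` is a left Ore set of `R`. -/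
def IsLeftOre {R : Type u} [Ring R] (S : Set R) : Prop :=
  IsMulSet S ∧ ∀ s ∈ S, ∀ r : R, ∃ s' ∈ S, ∃ r' : R, s' * r = r' * s

/-- `S` is a left denominator set of `R`. -/
def IsLeftDenom {R : Type u} [Ring R] (S : Set R) : Prop :=
  IsLeftOre S ∧ ∀ r : R, ∀ s ∈ S, r * s = 0 → ∃ t ∈ S, t * r = 0

/-- `S` is a right Ore set of `R`. -/
def IsRightOre {R : Type u} [Ring R] (S : Set R) : Prop :=
  IsMulSet S ∧ ∀ s ∈ S, ∀ r : R, ∃ s' ∈ S, ∃ r' : R, r * s' = s * r'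

/-- `S` is a right denominator set of `R`. -/
def IsRightDenom {R : Type u} [Ring R] (S : Set R) : Prop :=
  IsRightOre S ∧ ∀ r : R, ∀ s ∈ S, s * r = 0 → ∃ t ∈ S, r * t = 0

/-- `ass_R(S) = {r ∈ R | s r = 0 for some s ∈ S}`. -/
def ass {R : Type u} [Ring R] (S : Set R) : Set R := {r : R | ∃ s ∈ S, s * r = 0}

/-- `{r ∈ R | r s = 0 for some s ∈ S}` (the right-sided analogue of `ass`). -/
def rass {R : Type u} [Ring R] (S : Set R) : Set R := {r : R | ∃ s ∈ S, r * s = 0}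

/-- `S` is a (left) dense subset of `T`. -/
def DenseIn {R : Type u} [Ring R] (S T : Set R) : Prop := ∀ t ∈ T, ∃ r : R, r * t ∈ S

/-- `f : R →+* Q` realizes `Q` as the left localization `S⁻¹R` of `R` at `S`:
elements of `S` become units, every element of `Q` is a left fraction `(f s)⁻¹ * (f r)`,
and the kernel of `f` is `ass S`. -/
def IsLeftLoc {R : Type u} [Ring R] (S : Set R) {Q : Type u} [Ring Q] (f : R →+* Q) : Prop :=
  (∀ s ∈ S, IsUnit (f s)) ∧
  (∀ q : Q, ∃ s ∈ S, ∃ r : R, f s * q = f r) ∧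
  (∀ r : R, f r = 0 ↔ r ∈ ass S)

/-- `π : R →+* Q` realizes `Q` as the quotient of `R` by the set `a`
(in particular, `a` is then a two-sided ideal of `R`). -/
def IsQuotBy {R : Type u} [Ring R] (a : Set R) {Q : Type u} [Ring Q] (π : R →+* Q) : Prop :=
  Function.Surjective π ∧ ∀ r : R, π r = 0 ↔ r ∈ a

/-- A semiprime ring (no nonzero nilpotent ideals), elementwise: `x R x = 0 → x = 0`. -/
def SemiprimeRing (A : Type u) [Ring A] : Prop := ∀ x : A, (∀ r : A, x * r * x = 0) → x = 0

/-- `a` is a two-sided ideal of `R`, given as a set. -/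
def IsIdealSet {R : Type u} [Ring R] (a : Set R) : Prop :=
  (0 : R) ∈ a ∧ (∀ x ∈ a, ∀ y ∈ a, x + y ∈ a) ∧ ∀ r : R, ∀ x ∈ a, r * x ∈ a ∧ x * r ∈ a

/-- `a` is a semiprime (two-sided) ideal of `R`, i.e. `R/a` is a semiprime ring. -/
def IsSemiprimeIdealSet {R : Type u} [Ring R] (a : Set R) : Prop :=
  IsIdealSet a ∧ ∀ x : R, (∀ r : R, x * r * x ∈ a) → x ∈ a

/-- `a` is a prime (two-sided) ideal of `R`, i.e. `R/a` is a prime ring. -/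
def IsPrimeIdealSet {R : Type u} [Ring R] (a : Set R) : Prop :=
  IsIdealSet a ∧ a ≠ Set.univ ∧ ∀ x y : R, (∀ r : R, x * r * y ∈ a) → x ∈ a ∨ y ∈ a

/-- The prime radical of `A`: the intersection of all prime ideals of `A`. -/
def primeRadical (A : Type u) [Ring A] : Set A :=
  {x : A | ∀ p : Set A, IsPrimeIdealSet p → x ∈ p}

/-- The set of prime ideals of `R` minimal over `a`. -/
def minPrimesOver {R : Type u} [Ring R] (a : Set R) : Set (Set R) :=
  {p : Set R | IsPrimeIdealSet p ∧ a ⊆ p ∧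
    ∀ q : Set R, IsPrimeIdealSet q → a ⊆ q → q ⊆ p → q = p}

/-- A simple ring: nontrivial, with no two-sided ideals other than `0` and `A`. -/
def SimpleRing (A : Type u) [Ring A] : Prop :=
  (0 : A) ≠ 1 ∧ ∀ a : Set A, IsIdealSet a → a = {0} ∨ a = Set.univ

/-- A simple (left) Artinian ring. -/
def SimpleArtinianRing (A : Type u) [Ring A] : Prop := SimpleRing A ∧ IsArtinianRing A

/-- `I` is an essential left ideal of `R`. -/
def EssIdeal {R : Type u} [Ring R] (I : Submodule R R) : Prop :=
  ∀ J : Submodule R R, J ≠ ⊥ → I ⊓ J ≠ ⊥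

/-- `N` is an essential submodule of the left ideal `M`. -/
def EssIn {R : Type u} [Ring R] (N M : Submodule R R) : Prop :=
  N ≤ M ∧ ∀ W : Submodule R R, W ≤ M → W ≠ ⊥ → N ⊓ W ≠ ⊥

/-- `U` is a uniform left ideal of `R`. -/
def UniformIdeal {R : Type u} [Ring R] (U : Submodule R R) : Prop :=
  U ≠ ⊥ ∧ ∀ V W : Submodule R R, V ≤ U → W ≤ U → V ≠ ⊥ → W ≠ ⊥ → V ⊓ W ≠ ⊥

/-- `udim(_A A) < ∞`: there is a finite direct sum of uniform left ideals of `A`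
which is an essential left ideal of `A`. -/
def FinUdim (A : Type u) [Ring A] : Prop :=
  ∃ (n : ℕ) (U : Fin (n + 1) → Submodule A A),
    (∀ i, UniformIdeal (U i)) ∧
    (∀ i, U i ⊓ (⨆ j, ⨆ (_ : j ≠ i), U j) = ⊥) ∧
    EssIdeal (⨆ i, U i)

/-- `'C_V = {v ∈ V | right multiplication by v is injective on V}` for a left ideal `V`. -/
def lRegIn {R : Type u} [Ring R] (V : Submodule R R) : Set R :=
  {v : R | v ∈ V ∧ ∀ x ∈ V, x * v = 0 → x = 0}

/-- The family `P` of subsets of `R` satisfies the ascending chain condition. -/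
def AccOnSets {R : Type u} [Ring R] (P : Set (Set R)) : Prop :=
  ∀ f : ℕ → Set R, (∀ n, f n ∈ P) → (∀ n, f n ⊆ f (n + 1)) →
    ∃ N : ℕ, ∀ n : ℕ, N ≤ n → f n = f N

/-- The left annihilator of `X` in `R`. -/
def lAnn {R : Type u} [Ring R] (X : Set R) : Set R := {r : R | ∀ x ∈ X, r * x = 0}

/-- The right annihilator of `X` in `R`. -/
def rAnn {R : Type u} [Ring R] (X : Set R) : Set R := {r : R | ∀ x ∈ X, x * r = 0}

/-- A left Goldie ring: a.c.c. on left annihilators and finite left uniform dimension. -/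
def LeftGoldie (A : Type u) [Ring A] : Prop :=
  AccOnSets {B : Set A | ∃ X : Set A, B = lAnn X} ∧ FinUdim A

/-- The set of maximal left denominator sets of `A`. -/
def maxLeftDenom (A : Type u) [Ring A] : Set (Set A) :=
  {S : Set A | IsLeftDenom S ∧ ∀ T : Set A, IsLeftDenom T → S ⊆ T → S = T}

/-- `S_p = {c ∈ R | c + p ∈ C_{R/p}}`: the elements regular modulo `p`. -/
def regMod {R : Type u} [Ring R] (p : Set R) : Set R :=
  {c : R | (∀ x : R, x * c ∈ p → x ∈ p) ∧ ∀ x : R, c * x ∈ p → x ∈ p}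

/-- `I` is a right ideal of `R`, given as a set. -/
def IsRightIdealSet {R : Type u} [Ring R] (I : Set R) : Prop :=
  (0 : R) ∈ I ∧ (∀ x ∈ I, ∀ y ∈ I, x + y ∈ I) ∧ ∀ x ∈ I, ∀ r : R, x * r ∈ I

/-- The left singular ideal `ζ_l(R, a)` of `R` over `a`. -/
def leftSingularOver {R : Type u} [Ring R] (a : Set R) : Set R :=
  {r : R | ∃ I : Submodule R R, EssIdeal I ∧ a ⊆ I ∧ ∀ x ∈ I, x * r = 0}

theorem isLeftDenom_of_loc {R : Type u} [Ring R] {S : Set R} (hS : IsMulSet S)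
    {Q : Type u} [Ring Q] {f : R →+* Q} (hf : IsLeftLoc S f) : IsLeftDenom S := by
  obtain ⟨hu, hfr, hk⟩ := hf
  refine ⟨⟨hS, ?_⟩, ?_⟩
  · intro s hs r
    obtain ⟨u, hu'⟩ := hu s hs
    obtain ⟨t, ht, r', h⟩ := hfr (f r * (↑u⁻¹ : Q))
    have h0 : f (t * r - r' * s) = 0 := by
      rw [map_sub, map_mul, map_mul, ← h, ← hu', mul_assoc, mul_assoc, Units.inv_mul, mul_one,
        sub_self]
    obtain ⟨e, he, hz⟩ := (hk _).1 h0
    refine ⟨e * t, hS.2.1 e he t ht, e * r', ?_⟩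
    rw [mul_sub, sub_eq_zero] at hz
    rw [mul_assoc, hz, mul_assoc]
  · intro r s hs h
    refine (hk r).1 ?_
    apply (hu s hs).mul_left_eq_zero.1
    rw [← map_mul, h, map_zero]

theorem simpleRing_iff {A : Type u} [Ring A] : SimpleRing A ↔ IsSimpleRing A := by
  rw [isSimpleRing_iff_isTwoSided_imp]
  constructor
  · rintro ⟨h0, h⟩
    refine ⟨⟨0, 1, h0⟩, fun I hI => ?_⟩
    rcases h (I : Set A) ⟨I.zero_mem, fun x hx y hy => I.add_mem hx hy,
      fun r x hx => ⟨I.mul_mem_left r hx, I.mul_mem_right r hx⟩⟩ with h | h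
    · left
      apply SetLike.coe_injective
      rw [h]; rfl
    · right
      apply SetLike.coe_injective
      rw [h]; rfl
  · rintro ⟨h0, h⟩
    refine ⟨zero_ne_one, fun a ha => ?_⟩
    let I : Ideal A :=
      { carrier := a
        zero_mem' := ha.1
        add_mem' := fun {x y} hx hy => ha.2.1 x hx y hy
        smul_mem' := fun r x hx => (ha.2.2 r x hx).1 }
    have hI : (I : Set A) = a := rfl
    rcases h I ⟨fun {x} r hx => (ha.2.2 r x hx).2⟩ with h | h
    · left; rw [← hI, h]; rfl
    · right; rw [← hI, h]; rfl

theorem exists_unit_of_ideal {R : Type u} [Ring R] {S : Set R} (hS : IsLeftDenom S)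
    {Q : Type u} [Ring Q] {f : R →+* Q} (hf : IsLeftLoc S f) (hQ : SimpleArtinianRing Q)
    (I : Set R) (hI : IsIdealSet I) (x : R) (hx : x ∈ I) (hx0 : f x ≠ 0) :
    ∃ y ∈ I, IsUnit (f y) := by
  obtain ⟨hu, hfr, hk⟩ := hf
  obtain ⟨hsimp, hart⟩ := hQ
  let L : Submodule Q Q := Submodule.span Q (f '' I)
  have hR : ∀ r : R, ∀ q ∈ L, q * f r ∈ L := by
    intro r q hq
    induction hq using Submodule.span_induction with
    | mem q h =>
      obtain ⟨y, hy, rfl⟩ := h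
      rw [← map_mul]
      exact Submodule.subset_span ⟨_, (hI.2.2 r y hy).2, rfl⟩
    | zero => rw [zero_mul]; exact L.zero_mem
    | add a b _ _ ha hb => rw [add_mul]; exact L.add_mem ha hb
    | smul a b _ hb => rw [smul_mul_assoc]; exact L.smul_mem a hb
  have hU : ∀ s ∈ S, ∀ q ∈ L, ∃ p ∈ L, p * f s = q := by
    intro s hs q hq
    let g : L →ₗ[Q] L := (LinearMap.toSpanSingleton Q Q (f s)).restrict (hR s)
    have hg : Function.Injective g := by
      intro a b hab
      have h1 : (a : Q) * f s = b * f s := congrArg Subtype.val hab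
      exact Subtype.ext ((hu s hs).mul_right_cancel h1)
    obtain ⟨p, hp⟩ := IsArtinian.surjective_of_injective_endomorphism g hg ⟨q, hq⟩
    exact ⟨p, p.2, congrArg Subtype.val hp⟩
  have hT : ∀ z : Q, ∀ q ∈ L, q * z ∈ L := by
    intro z q hq
    obtain ⟨s, hs, r, h⟩ := hfr z
    obtain ⟨p, hp, rfl⟩ := hU s hs q hq
    rw [mul_assoc, h]
    exact hR r p hp
  have h1 : (1 : Q) ∈ L := by
    rcases hsimp.2 (L : Set Q) ⟨L.zero_mem, fun x hx y hy => L.add_mem hx hy,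
      fun r x hx => ⟨L.smul_mem r hx, hT r x hx⟩⟩ with h | h
    · exfalso
      have : f x ∈ (L : Set Q) := Submodule.subset_span ⟨x, hx, rfl⟩
      rw [h] at this
      exact hx0 this
    · have : (1 : Q) ∈ (L : Set Q) := by rw [h]; trivial
      exact this
  have hfrac : ∀ q ∈ L, ∃ s ∈ S, ∃ y ∈ I, f s * q = f y := by
    intro q hq
    induction hq using Submodule.span_induction with
    | mem q h =>
      obtain ⟨y, hy, rfl⟩ := h
      exact ⟨1, hS.1.1.1, y, hy, by simp⟩
    | zero => exact ⟨1, hS.1.1.1, 0, hI.1, by simp⟩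
    | add a b _ _ ha hb =>
      obtain ⟨s, hs, y, hy, h⟩ := ha
      obtain ⟨s2, hs2, y2, hy2, h2⟩ := hb
      obtain ⟨t, ht, r, h3⟩ := hS.1.2 s2 hs2 s
      refine ⟨t * s, hS.1.1.2.1 t ht s hs, t * y + r * y2,
        hI.2.1 _ (hI.2.2 t y hy).1 _ (hI.2.2 r y2 hy2).1, ?_⟩
      rw [mul_add, map_add, map_mul f t y, map_mul f r y2, ← h, ← h2, ← mul_assoc, ← mul_assoc,
        ← map_mul, ← map_mul, h3]
    | smul a b _ hb =>
      obtain ⟨s, hs, y, hy, h⟩ := hb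
      obtain ⟨u, hu'⟩ := hu s hs
      obtain ⟨t, ht, r, h2⟩ := hfr (a * (↑u⁻¹ : Q))
      refine ⟨t, ht, r * y, (hI.2.2 r y hy).1, ?_⟩
      rw [map_mul, ← h, ← h2, ← hu', smul_eq_mul]
      simp [mul_assoc]
  obtain ⟨s, hs, y, hy, h⟩ := hfrac 1 h1
  refine ⟨y, hy, ?_⟩
  rw [← h, mul_one]
  exact hu s hs

/-- The preimage of the units. -/
theorem loc_units {R : Type u} [Ring R] {Q : Type u} [Ring Q] [Nontrivial Q] (f : R →+* Q)
    (hfr : ∀ q : Q, ∃ s : R, IsUnit (f s) ∧ ∃ r : R, f s * q = f r)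
    (hk : ∀ x : R, f x = 0 → ∃ s, IsUnit (f s) ∧ s * x = 0) :
    IsLeftDenom {s | IsUnit (f s)} ∧ IsLeftLoc {s | IsUnit (f s)} f := by
  have hl : IsLeftLoc {s | IsUnit (f s)} f := by
    refine ⟨fun s hs => hs, hfr, fun r => ⟨hk r, ?_⟩⟩
    rintro ⟨s, hs, h⟩
    apply (IsUnit.mul_right_eq_zero hs).1
    rw [← map_mul, h, map_zero]
  refine ⟨isLeftDenom_of_loc ⟨by simp, ?_, by simp⟩ hl, hl⟩
  intro a ha b hb
  simp only [Set.mem_ofPred_eq, map_mul] at *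
  exact ha.mul hb

/-- An element that is left regular in the image is a unit of the Artinian localization. -/
theorem isUnit_of_lreg_image {R : Type u} [Ring R] {Q : Type u} [Ring Q] [IsArtinianRing Q]
    (f : R →+* Q) (hfr : ∀ q : Q, ∃ s : R, IsUnit (f s) ∧ ∃ r : R, f s * q = f r)
    (t : R) (ht : ∀ x : R, f x * f t = 0 → f x = 0) : IsUnit (f t) := by
  rw [IsArtinianRing.isUnit_iff_isRightRegular]
  intro a b hab
  rw [← sub_eq_zero]
  have hq : (a - b) * f t = 0 := by
    rw [sub_mul, sub_eq_zero]
    exact hab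
  generalize a - b = q at hq ⊢
  obtain ⟨s, hs, r, h⟩ := hfr q
  have : f r = 0 := by
    apply ht
    rw [← h, mul_assoc, hq, mul_zero]
  rw [this] at h
  exact (IsUnit.mul_right_eq_zero hs).1 h

theorem forward_dir {R : Type u} [Ring R] (hden : IsLeftDenom (lReg R))
    {Q : Type u} [Ring Q] (f : R →+* Q) (hf : IsLeftLoc (lReg R) f) (hQ : IsSemisimpleRing Q) :
    ∃ (n : ℕ) (S : Fin (n + 1) → Set R),
      (∀ i, IsLeftDenom (S i)) ∧
      (∀ i, ∃ (Q : Type u) (_ : Ring Q) (f : R →+* Q),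
        IsLeftLoc (S i) f ∧ SimpleArtinianRing Q) ∧
      ass (lReg R) = ⋂ i, ass (S i) ∧
      (∃ (Rb : Type u) (_ : Ring Rb) (π : R →+* Rb),
        IsQuotBy (ass (lReg R)) π ∧
        π '' lReg R ⊆ reg Rb ∧ DenseIn (π '' lReg R) (reg Rb)) := by
  obtain ⟨hu, hfr, hk⟩ := hf
  have hfr' : ∀ q : Q, ∃ s : R, IsUnit (f s) ∧ ∃ r : R, f s * q = f r := fun q => by
    obtain ⟨s, hs, r, h⟩ := hfr q
    exact ⟨s, hu s hs, r, h⟩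
  have hart : IsArtinianRing Q := inferInstance
  have hnt : Nontrivial Q := by
    refine ⟨0, 1, fun h => ?_⟩
    rw [← map_one f] at h
    obtain ⟨s, hs, h2⟩ := (hk 1).1 h.symm
    rw [mul_one] at h2
    exact hden.1.1.2.2 (h2 ▸ hs)
  obtain ⟨n, D, d, _, hd, ⟨e⟩⟩ := IsSemisimpleRing.exists_ringEquiv_pi_matrix_divisionRing Q
  cases n with
  | zero =>
    exfalso
    have := e.symm.surjective.subsingleton
    exact not_subsingleton Q this
  | succ n =>
  let g : ∀ i, R →+* Matrix (Fin (d i)) (Fin (d i)) (D i) := fun i =>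
    (Pi.evalRingHom (fun i => Matrix (Fin (d i)) (Fin (d i)) (D i)) i).comp
      (e.toRingHom.comp f)
  have hg : ∀ i r, g i r = e (f r) i := fun i r => rfl
  have hgu : ∀ i, ∀ s ∈ lReg R, IsUnit (g i s) := fun i s hs =>
    ((hu s hs).map e.toRingHom).map (Pi.evalRingHom (fun i => Matrix (Fin (d i)) (Fin (d i)) (D i)) i)
  have hS : ∀ i, IsLeftDenom {s | IsUnit (g i s)} ∧ IsLeftLoc {s | IsUnit (g i s)} (g i) := by
    intro i
    have := hd i
    apply loc_units
    · intro q
      obtain ⟨s, hs, r, h⟩ := hfr (e.symm (Pi.single i q))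
      refine ⟨s, hgu i s hs, r, ?_⟩
      have h2 := congrFun (congrArg e h) i
      rw [map_mul, Pi.mul_apply, RingEquiv.apply_symm_apply, Pi.single_eq_same] at h2
      exact h2
    · intro x hx
      obtain ⟨c, hc, y, h⟩ := hfr (e.symm (Pi.single i 1))
      have h2 : e (f c) * Pi.single i 1 = e (f y) := by
        rw [← h, map_mul, RingEquiv.apply_symm_apply]
      have h3 : f (y * x) = 0 := by
        apply e.injective
        rw [map_mul, map_mul, ← h2, map_zero, mul_assoc]
        convert mul_zero _
        ext1 j
        rw [Pi.mul_apply]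
        by_cases hj : j = i
        · subst hj
          rw [← hg, hx, mul_zero, Pi.zero_apply]
        · rw [Pi.single_eq_of_ne hj, zero_mul, Pi.zero_apply]
      obtain ⟨b, hb, h4⟩ := (hk _).1 h3
      refine ⟨b * y, ?_, by rw [mul_assoc, h4]⟩
      rw [map_mul]
      refine (hgu i b hb).mul ?_
      have h5 := congrFun h2 i
      rw [Pi.mul_apply, Pi.single_eq_same, mul_one] at h5
      rw [hg, ← h5]
      exact hgu i c hc
  refine ⟨n, fun i => {s | IsUnit (g i s)}, fun i => (hS i).1, fun i =>
    ⟨_, inferInstance, g i, (hS i).2, ?_, ?_⟩, ?_, f.range, inferInstance, f.rangeRestrict,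
    ⟨f.rangeRestrict_surjective, ?_⟩, ?_, ?_⟩
  · have := hd i
    rw [simpleRing_iff]
    infer_instance
  · infer_instance
  · ext r
    rw [Set.mem_iInter, ← hk]
    constructor
    · intro h i
      rw [← (hS i).2.2.2, hg, h, map_zero]
      rfl
    · intro h
      apply e.injective
      rw [map_zero]
      ext1 i
      exact ((hS i).2.2.2 r).2 (h i)
  · intro r
    rw [← hk, ← f.coe_rangeRestrict r, Subring.coe_eq_zero_iff]
  · rintro _ ⟨c, hc, rfl⟩
    have := hu c hc
    refine ⟨fun x hx => ?_, fun x hx => ?_⟩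
    · apply Subtype.ext
      exact (IsUnit.mul_left_eq_zero this).1 (congrArg Subtype.val hx)
    · apply Subtype.ext
      exact (IsUnit.mul_right_eq_zero this).1 (congrArg Subtype.val hx)
  · intro t ht
    obtain ⟨t, rfl⟩ := f.rangeRestrict_surjective t
    have hut : IsUnit (f t) := by
      apply isUnit_of_lreg_image f hfr'
      intro x hx
      have := ht.1 (f.rangeRestrict x) (Subtype.ext hx)
      exact congrArg Subtype.val this
    obtain ⟨u, hu'⟩ := hut
    obtain ⟨c, hc, r, h⟩ := hfr (↑u⁻¹ : Q)
    refine ⟨f.rangeRestrict r, c, hc, ?_⟩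
    apply Subtype.ext
    change f c = f r * f t
    rw [← h, ← hu', mul_assoc, Units.inv_mul, mul_one]

theorem backward_dir {R : Type u} [Ring R] (n : ℕ) (S : Fin (n + 1) → Set R)
    (hS : ∀ i, IsLeftDenom (S i))
    (Q : Fin (n + 1) → Type u) [∀ i, Ring (Q i)] (f : ∀ i, R →+* Q i)
    (hf : ∀ i, IsLeftLoc (S i) (f i)) (hQ : ∀ i, SimpleArtinianRing (Q i))
    (hass : ass (lReg R) = ⋂ i, ass (S i))
    {Rb : Type u} [Ring Rb] (π : R →+* Rb) (hπ : IsQuotBy (ass (lReg R)) π)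
    (hreg : π '' lReg R ⊆ reg Rb) (hdense : DenseIn (π '' lReg R) (reg Rb)) :
    IsLeftDenom (lReg R) ∧
      ∃ (Q : Type u) (_ : Ring Q) (f : R →+* Q),
        IsLeftLoc (lReg R) f ∧ IsSemisimpleRing Q := by
  classical
  have hss : ∀ i, IsSemisimpleRing (Q i) := fun i => by
    have h1 := simpleRing_iff.1 (hQ i).1
    have h2 := (hQ i).2
    infer_instance
  have hall : ∀ r, r ∈ ass (lReg R) ↔ ∀ i, f i r = 0 := by
    intro r
    rw [hass, Set.mem_iInter]
    exact forall_congr' fun i => ((hf i).2.2 r).symm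
  obtain ⟨J, hJ, hmin⟩ := (wellFounded_lt (α := Finset (Fin (n + 1)))).has_min
    {J | ∀ r, (∀ i ∈ J, f i r = 0) → r ∈ ass (lReg R)}
    ⟨Finset.univ, fun r h => (hall r).2 fun i => h i (Finset.mem_univ i)⟩
  -- units in the intersections of the other kernels
  have hy : ∀ i : J, ∃ y : R, (∀ j : J, j ≠ i → f j y = 0) ∧ IsUnit (f i y) := by
    rintro ⟨i, hi⟩
    have h1 : ¬ ∀ r, (∀ j ∈ J.erase i, f j r = 0) → r ∈ ass (lReg R) := fun h =>
      hmin _ h (Finset.erase_ssubset hi)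
    push Not at h1
    obtain ⟨x, hx, hxa⟩ := h1
    have hx0 : f i x ≠ 0 := by
      intro h
      apply hxa
      apply hJ
      intro j hj
      by_cases hji : j = i
      · rw [hji]; exact h
      · exact hx j (Finset.mem_erase.2 ⟨hji, hj⟩)
    obtain ⟨y, hy, hyu⟩ := exists_unit_of_ideal (hS i) (hf i) (hQ i)
      {r | ∀ j ∈ J.erase i, f j r = 0} ⟨fun j _ => map_zero _,
        fun x hx y hy j hj => by rw [map_add, hx j hj, hy j hj, add_zero],
        fun r x hx => ⟨fun j hj => by rw [map_mul, hx j hj, mul_zero],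
          fun j hj => by rw [map_mul, hx j hj, zero_mul]⟩⟩ x hx hx0
    refine ⟨y, fun j hj => hy j (Finset.mem_erase.2 ⟨fun h => hj (Subtype.ext h), j.2⟩), hyu⟩
  choose y hy0 hyu using hy
  let F : R →+* (∀ i : J, Q i) := RingHom.pi fun i => f i
  have hF : ∀ r (i : J), F r i = f i r := fun r i => rfl
  have hker : ∀ r, F r = 0 ↔ r ∈ ass (lReg R) := by
    intro r
    constructor
    · intro h
      exact hJ r fun i hi => congrFun h ⟨i, hi⟩
    · intro h
      ext1 i
      exact (hall r).1 h i
  have hsum : ∀ (z : J → R) (i : J), f i (∑ j, y j * z j) = f i (y i) * f i (z i) := by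
    intro z i
    rw [map_sum, Finset.sum_eq_single i, map_mul]
    · intro j _ hj
      rw [map_mul, hy0 j i hj.symm, zero_mul]
    · simp
  have hfrac : ∀ q : (∀ i : J, Q i), ∃ s : R, IsUnit (F s) ∧ ∃ r : R, F s * q = F r := by
    intro q
    choose s hs r h using fun i : J => (hf i).2.1 (q i)
    refine ⟨∑ j, y j * s j, ?_, ∑ j, y j * r j, ?_⟩
    · rw [Pi.isUnit_iff]
      intro i
      rw [hF, hsum]
      exact (hyu i).mul ((hf i).1 _ (hs i))
    · ext1 i
      rw [Pi.mul_apply, hF, hF, hsum, hsum, mul_assoc, h]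
  have hFπ : ∀ a b : R, F a = F b ↔ π a = π b := by
    intro a b
    rw [← sub_eq_zero, ← map_sub, hker, ← hπ.2, map_sub, sub_eq_zero]
  have hFπ0 : ∀ a : R, F a = 0 ↔ π a = 0 := fun a => by rw [hker, hπ.2]
  have hart : IsArtinianRing (∀ i : J, Q i) := inferInstance
  have hunit : ∀ c ∈ lReg R, IsUnit (F c) := by
    intro c hc
    apply isUnit_of_lreg_image F hfrac
    intro x hx
    rw [hFπ0]
    apply (hreg ⟨c, hc, rfl⟩).1
    rw [← map_mul, ← hFπ0, map_mul, hx]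
  have hloc : IsLeftLoc (lReg R) F := by
    refine ⟨hunit, ?_, hker⟩
    intro q
    obtain ⟨c, hc, r, h⟩ := hfrac q
    have hcreg : π c ∈ reg Rb := by
      constructor
      · intro x hx
        obtain ⟨x, rfl⟩ := hπ.1 x
        rw [← map_mul, ← hFπ0, map_mul] at hx
        rw [← hFπ0]
        exact (IsUnit.mul_left_eq_zero hc).1 hx
      · intro x hx
        obtain ⟨x, rfl⟩ := hπ.1 x
        rw [← map_mul, ← hFπ0, map_mul] at hx
        rw [← hFπ0]
        exact (IsUnit.mul_right_eq_zero hc).1 hx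
    obtain ⟨b, d, hd, hbd⟩ := hdense _ hcreg
    obtain ⟨b, rfl⟩ := hπ.1 b
    rw [← map_mul, ← hFπ] at hbd
    exact ⟨d, hd, b * r, by rw [hbd, map_mul, map_mul, mul_assoc, h]⟩
  refine ⟨isLeftDenom_of_loc ⟨?_, ?_, ?_⟩ hloc, _, inferInstance, F, hloc, inferInstance⟩
  · intro x hx
    rwa [mul_one] at hx
  · intro a ha b hb x hx
    exact ha x (hb _ (by rw [mul_assoc, hx]))
  · intro h
    have h1 : (1 : R) = 0 := h 1 (mul_zero 1)
    exact (hS 0).1.1.2.2 (h1 ▸ (hS 0).1.1.1)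

/-- Theorem A7Mar15: `'Q_{l,cl}(R)` is semisimple Artinian iff there are left denominator
sets `S_1, …, S_n` of `R` with simple Artinian localizations `S_i⁻¹R`, with
`a = ⋂ ass_R(S_i)`, and such that `'C̄` is a dense subset of `C_{R̄}` where `R̄ = R/a`. -/
theorem classicalLeftRegularLeftQuotient_semisimple_iff_denomSets {R : Type u} [Ring R] :
    (IsLeftDenom (lReg R) ∧
      ∃ (Q : Type u) (_ : Ring Q) (f : R →+* Q),
        IsLeftLoc (lReg R) f ∧ IsSemisimpleRing Q) ↔
    (∃ (n : ℕ) (S : Fin (n + 1) → Set R),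
      (∀ i, IsLeftDenom (S i)) ∧
      -- (a)
      (∀ i, ∃ (Q : Type u) (_ : Ring Q) (f : R →+* Q),
        IsLeftLoc (S i) f ∧ SimpleArtinianRing Q) ∧
      -- (b)
      ass (lReg R) = ⋂ i, ass (S i) ∧
      -- (c)
      (∃ (Rb : Type u) (_ : Ring Rb) (π : R →+* Rb),
        IsQuotBy (ass (lReg R)) π ∧
        π '' lReg R ⊆ reg Rb ∧ DenseIn (π '' lReg R) (reg Rb))) := by
  constructor
  · rintro ⟨hden, Q, _, f, hf, hQ⟩
    exact forward_dir hden f hf hQ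
  · rintro ⟨n, S, hS, hloc, hass, Rb, _, π, hπ, hreg, hdense⟩
    choose Q _ f hf hQ using hloc
    exact backward_dir n S hS Q f hf hQ hass π hπ hreg hdense

end Bavula
end

section
/- Let R be a semiprime right Noetherian ring with udim(_R R) < ∞ such that 'C_U ≠ ∅ for all uniform left ideals U of R. Then the set C_R of regular elements of R is a left Ore set and the classical left quotient ring Q_{l,cl}(R) := C_R⁻¹R is a semisimple Artinian ring. -/
universe u

namespace Bavula

/-! ### Auxiliary lemmas -/

section Aux

variable {R : Type u} [Ring R]

theorem eq_zero_of_inf {V W : Submodule R R} (h : V ⊓ W = ⊥) {x : R} (hV : x ∈ V)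
    (hW : x ∈ W) : x = 0 := by
  have : x ∈ V ⊓ W := ⟨hV, hW⟩
  rw [h] at this
  exact (Submodule.mem_bot R).1 this

theorem inf_eq_bot_of {V W : Submodule R R} (h : ∀ x ∈ V, x ∈ W → x = 0) : V ⊓ W = ⊥ := by
  rw [Submodule.eq_bot_iff]
  exact fun x hx => h x hx.1 hx.2

theorem inf_ne_bot_of {V W : Submodule R R} {x : R} (hV : x ∈ V) (hW : x ∈ W) (hx : x ≠ 0) :
    V ⊓ W ≠ ⊥ := fun h => hx (eq_zero_of_inf h hV hW)

theorem exists_of_inf_ne_bot {V W : Submodule R R} (h : V ⊓ W ≠ ⊥) :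
    ∃ x ∈ V, x ∈ W ∧ x ≠ 0 := by
  obtain ⟨x, hx, h0⟩ := (Submodule.ne_bot_iff _).1 h
  exact ⟨x, hx.1, hx.2, h0⟩

/-- right multiplication by `c` as a left linear map. -/
def rmul (c : R) : R →ₗ[R] R := LinearMap.toSpanSingleton R R c

theorem rmul_apply (c x : R) : rmul c x = x * c := rfl

/-- `B` misses a nonzero submodule of `M`. -/
def Prec (B M : Submodule R R) : Prop := B ≤ M ∧ ∃ A ≤ M, A ≠ ⊥ ∧ A ⊓ B = ⊥

theorem span_ne_bot {x : R} (hx : x ≠ 0) : Submodule.span R {x} ≠ ⊥ := by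
  simpa using hx

/-- A submodule meeting each member of an independent family of uniforms is essential
in the sum. -/
theorem meets_of_finset {ι : Type*} [DecidableEq ι] (U : ι → Submodule R R)
    (hU : ∀ i, UniformIdeal (U i))
    (hind : ∀ i, U i ⊓ (⨆ j, ⨆ (_ : j ≠ i), U j) = ⊥) (N : Submodule R R)
    (hN : ∀ i, N ⊓ U i ≠ ⊥) (s : Finset ι) :
    ∀ J : Submodule R R, J ≤ (⨆ i ∈ s, U i) → J ≠ ⊥ → N ⊓ J ≠ ⊥ := by
  induction s using Finset.induction_on with
  | empty =>
    intro J hJ h0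
    simp only [Finset.notMem_empty, iSup_false, iSup_bot, le_bot_iff] at hJ
    exact absurd hJ h0
  | insert a s ha ih =>
    intro J hJ h0
    set W := ⨆ i ∈ s, U i with hW
    rw [Finset.iSup_insert] at hJ
    have hWd : U a ⊓ W = ⊥ := by
      rw [eq_bot_iff, ← hind a]
      refine inf_le_inf_left _ ?_
      refine iSup₂_le fun i hi => ?_
      exact le_iSup₂_of_le i (fun h => ha (h ▸ hi)) le_rfl
    by_cases hJW : J ⊓ W = ⊥
    · obtain ⟨j, hj, hj0⟩ := (Submodule.ne_bot_iff _).1 h0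
      obtain ⟨u, hu, w, hw, rfl⟩ := Submodule.mem_sup.1 (hJ hj)
      have hu0 : u ≠ 0 := by
        rintro rfl
        rw [zero_add] at hj hj0
        exact hj0 (eq_zero_of_inf hJW hj hw)
      have h1 := (hU a).2 (N ⊓ U a) (Submodule.span R {u}) inf_le_right
        (by simpa using hu) (hN a) (span_ne_bot hu0)
      obtain ⟨y, hy, hy2, hy0⟩ := exists_of_inf_ne_bot h1
      obtain ⟨r, rfl⟩ := Submodule.mem_span_singleton.1 hy2
      by_cases hrw : r • w = 0
      · refine inf_ne_bot_of hy.1 ?_ hy0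
        have := J.smul_mem r hj
        rwa [smul_add, hrw, add_zero] at this
      · have h2 := ih (Submodule.span R {r • w}) (by simpa using W.smul_mem r hw)
          (span_ne_bot hrw)
        obtain ⟨z, hz, hz2, hz0⟩ := exists_of_inf_ne_bot h2
        obtain ⟨t, rfl⟩ := Submodule.mem_span_singleton.1 hz2
        have hJ' : t • r • u + t • r • w ∈ J := by
          have := J.smul_mem t (J.smul_mem r hj)
          rwa [smul_add, smul_add] at this
        refine inf_ne_bot_of (N.add_mem (N.smul_mem t hy.1) hz) hJ' ?_
        intro h
        have h3 : t • r • w ∈ U a := by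
          rw [← neg_eq_of_add_eq_zero_right h]
          exact (U a).neg_mem ((U a).smul_mem _ ((U a).smul_mem _ hu))
        exact hz0 (eq_zero_of_inf hWd h3 (W.smul_mem _ (W.smul_mem _ hw)))
    · intro h
      refine ih (J ⊓ W) inf_le_right hJW ?_
      rw [eq_bot_iff, ← h]
      exact inf_le_inf_left _ inf_le_left

theorem essential_of_meets {n : ℕ} (U : Fin n → Submodule R R)
    (hU : ∀ i, UniformIdeal (U i))
    (hind : ∀ i, U i ⊓ (⨆ j, ⨆ (_ : j ≠ i), U j) = ⊥) (hess : EssIdeal (⨆ i, U i))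
    (N : Submodule R R) (hN : ∀ i, N ⊓ U i ≠ ⊥) : EssIdeal N := by
  intro J hJ h
  refine meets_of_finset U hU hind N hN Finset.univ ((⨆ i, U i) ⊓ J) ?_ (hess J hJ) ?_
  · simp
  · rw [eq_bot_iff, ← h]
    exact inf_le_inf_left _ inf_le_right

theorem acc_of_finUdim (hud : FinUdim R) (M : Submodule R R) : Acc Prec M := by
  classical
  obtain ⟨n, U, hU, hind, hess⟩ := hud
  suffices H : ∀ (k : ℕ) (T : Finset (Fin (n + 1))), n + 1 - T.card = k →
      ∀ M : Submodule R R, M ⊓ (⨆ i ∈ T, U i) = ⊥ → Acc Prec M by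
    exact H _ ∅ rfl M (by simp)
  intro k
  induction k using Nat.strong_induction_on with
  | _ k ih =>
  intro T hT M hM
  constructor
  rintro B ⟨hBM, A, hAM, hA0, hAB⟩
  set W := ⨆ i ∈ T, U i with hW
  by_contra hB
  have key : EssIdeal (B ⊔ W) := by
    refine essential_of_meets U hU hind hess _ fun i => ?_
    by_cases hi : i ∈ T
    · have : U i ≤ B ⊔ W := le_trans (le_iSup₂_of_le i hi le_rfl) le_sup_right
      rw [inf_eq_right.2 this]
      exact (hU i).1
    · have h1 : B ⊓ (⨆ j ∈ insert i T, U j) ≠ ⊥ := by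
        intro h
        refine hB (ih _ ?_ (insert i T) rfl B h)
        have h2 := Finset.card_le_univ (insert i T)
        rw [Fintype.card_fin, Finset.card_insert_of_notMem hi] at h2
        rw [Finset.card_insert_of_notMem hi]
        omega
      rw [Finset.iSup_insert] at h1
      obtain ⟨b, hb, hb2, hb0⟩ := exists_of_inf_ne_bot h1
      obtain ⟨x, hx, w, hw, rfl⟩ := Submodule.mem_sup.1 hb2
      have hx0 : x ≠ 0 := by
        rintro rfl
        rw [zero_add] at hb hb0
        exact hb0 (eq_zero_of_inf hM (hBM hb) hw)
      refine inf_ne_bot_of (x := x) ?_ hx hx0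
      have := (B ⊔ W).sub_mem (Submodule.mem_sup_left hb) (Submodule.mem_sup_right hw)
      rwa [add_sub_cancel_right] at this
  obtain ⟨a, ha, ha2, ha0⟩ := exists_of_inf_ne_bot (key A hA0)
  obtain ⟨b, hb, w, hw, rfl⟩ := Submodule.mem_sup.1 ha
  have hwM : w ∈ M := by
    have := M.sub_mem (hAM ha2) (hBM hb)
    rwa [add_sub_cancel_left] at this
  have hw0 := eq_zero_of_inf hM hwM hw
  subst hw0
  rw [add_zero] at ha2 ha0
  exact ha0 (eq_zero_of_inf hAB ha2 hb)

theorem exists_uniform {J : Submodule R R} (hacc : Acc Prec J) (hJ : J ≠ ⊥) :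
    ∃ V ≤ J, UniformIdeal V := by
  induction hacc with
  | intro J _ ih =>
  by_cases hu : UniformIdeal J
  · exact ⟨J, le_rfl, hu⟩
  · unfold UniformIdeal at hu
    push Not at hu
    obtain ⟨V, W, hV, hW, hV0, hW0, hVW⟩ := hu hJ
    obtain ⟨X, hX, hXu⟩ := ih W ⟨hW, V, hV, hV0, hVW⟩ hW0
    exact ⟨X, hX.trans hW, hXu⟩

theorem ess_comap {I : Submodule R R} (hI : EssIdeal I) (r : R) :
    EssIdeal (I.comap (rmul r)) := by
  intro J hJ h
  by_cases hJr : J.map (rmul r) = ⊥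
  · obtain ⟨j, hj, hj0⟩ := (Submodule.ne_bot_iff _).1 hJ
    refine hj0 (eq_zero_of_inf h ?_ hj)
    have h1 : rmul r j ∈ J.map (rmul r) := Submodule.mem_map_of_mem hj
    rw [hJr, Submodule.mem_bot] at h1
    rw [Submodule.mem_comap, h1]
    exact I.zero_mem
  · obtain ⟨y, hy, hy2, hy0⟩ := exists_of_inf_ne_bot (hI _ hJr)
    obtain ⟨j, hj, rfl⟩ := hy2
    have := eq_zero_of_inf h hy hj
    rw [this, map_zero] at hy0
    exact hy0 rfl

theorem nonsing (hud : FinUdim R)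
    (huni : ∀ U : Submodule R R, UniformIdeal U → (lRegIn U).Nonempty) {z : R}
    (hz : EssIdeal (LinearMap.ker (rmul z))) : z = 0 := by
  by_contra hz0
  obtain ⟨V, hV, hVu⟩ := exists_uniform (acc_of_finUdim hud _) (span_ne_bot hz0)
  obtain ⟨v, hv, hv2⟩ := huni V hVu
  obtain ⟨r, rfl⟩ := Submodule.mem_span_singleton.1 (hV hv)
  obtain ⟨x, hx, hxV, hx0⟩ := exists_of_inf_ne_bot (ess_comap hz r V hVu.1)
  refine hx0 (hv2 x hxV ?_)
  rw [Submodule.mem_comap, LinearMap.mem_ker, rmul_apply, rmul_apply] at hx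
  rw [smul_eq_mul, ← mul_assoc, hx]

theorem exists_elem
    (huni : ∀ U : Submodule R R, UniformIdeal U → (lRegIn U).Nonempty)
    {A : Submodule R R} (hacc : Acc Prec A) :
    ∃ c ∈ A, ∀ x ∈ A, x * c = 0 → x = 0 := by
  induction hacc with
  | intro A hA ih =>
  by_cases h0 : A = ⊥
  · subst h0
    exact ⟨0, Submodule.zero_mem _, fun x hx _ => by simpa using hx⟩
  · obtain ⟨U, hU, hUu⟩ := exists_uniform (Acc.intro A hA) h0
    obtain ⟨u, hu, hu2⟩ := huni U hUu
    have hd : U ⊓ (A ⊓ LinearMap.ker (rmul u)) = ⊥ :=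
      inf_eq_bot_of fun x hx hx2 => hu2 x hx hx2.2
    obtain ⟨c, hc, hc2⟩ := ih (A ⊓ LinearMap.ker (rmul u))
      ⟨inf_le_left, U, hU, hUu.1, hd⟩
    refine ⟨u + c, A.add_mem (hU hu) hc.1, fun x hx hxc => ?_⟩
    rw [mul_add] at hxc
    have h1 : x * u ∈ A ⊓ LinearMap.ker (rmul u) := by
      rw [eq_neg_of_add_eq_zero_left hxc]
      exact Submodule.neg_mem _ (Submodule.smul_mem _ x hc)
    have h2 : x * u = 0 := eq_zero_of_inf hd (U.smul_mem x hu) h1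
    rw [h2, zero_add] at hxc
    exact hc2 x ⟨hx, h2⟩ hxc

theorem exists_lReg_of_ess (hud : FinUdim R)
    (huni : ∀ U : Submodule R R, UniformIdeal U → (lRegIn U).Nonempty)
    {I : Submodule R R} (hI : EssIdeal I) : ∃ c ∈ I, c ∈ lReg R := by
  obtain ⟨c, hc, hc2⟩ := exists_elem huni (acc_of_finUdim hud I)
  refine ⟨c, hc, fun x hx => ?_⟩
  by_contra hx0
  have : LinearMap.ker (rmul c) ≠ ⊥ := (Submodule.ne_bot_iff _).2 ⟨x, hx, hx0⟩
  obtain ⟨y, hy, hy2, hy0⟩ := exists_of_inf_ne_bot (hI _ this)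
  exact hy0 (hc2 y hy hy2)

theorem ess_of_lReg (hud : FinUdim R) {c : R} (hc : c ∈ lReg R) :
    EssIdeal (LinearMap.range (rmul c)) := by
  intro J hJ h
  have hinj : Function.Injective (rmul c) := by
    rw [injective_iff_map_eq_zero]
    exact fun x hx => hc x hx
  suffices H : ∀ M : Submodule R R, Acc Prec M →
      ∀ φ : R →ₗ[R] R, Function.Injective φ → LinearMap.range φ = M → False from
    H ⊤ (acc_of_finUdim hud ⊤) LinearMap.id Function.injective_id LinearMap.range_id
  intro M hM
  induction hM with
  | intro M _ ih =>
  intro φ hφ hr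
  refine ih _ ?_ (φ.comp (rmul c)) (hφ.comp hinj) rfl
  refine ⟨?_, J.map φ, ?_, ?_, ?_⟩
  · rw [← hr]; exact LinearMap.range_comp_le_range _ _
  · rw [← hr]; exact LinearMap.map_le_range
  · intro h0
    obtain ⟨j, hj, hj0⟩ := (Submodule.ne_bot_iff _).1 hJ
    have h1 : φ j ∈ J.map φ := Submodule.mem_map_of_mem hj
    rw [h0, Submodule.mem_bot] at h1
    exact hj0 (hφ (by rw [h1, map_zero]))
  · refine inf_eq_bot_of ?_
    rintro _ ⟨j, hj, rfl⟩ ⟨x, hx⟩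
    have : rmul c x = j := hφ hx
    have h2 : j = 0 := eq_zero_of_inf h ⟨x, this⟩ hj
    rw [h2, map_zero]

theorem lReg_sub_reg (hud : FinUdim R)
    (huni : ∀ U : Submodule R R, UniformIdeal U → (lRegIn U).Nonempty)
    {c : R} (hc : c ∈ lReg R) : c ∈ reg R := by
  refine ⟨hc, fun x hx => nonsing hud huni ?_⟩
  intro J hJ
  obtain ⟨y, ⟨r, rfl⟩, hy2, hy0⟩ := exists_of_inf_ne_bot (ess_of_lReg hud hc J hJ)
  refine inf_ne_bot_of ?_ hy2 hy0
  rw [LinearMap.mem_ker, rmul_apply, rmul_apply, mul_assoc, hx, mul_zero]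

theorem leftOre (hud : FinUdim R)
    (huni : ∀ U : Submodule R R, UniformIdeal U → (lRegIn U).Nonempty) :
    IsLeftOre (reg R) := by
  refine ⟨⟨⟨fun x hx => by simpa using hx, fun x hx => by simpa using hx⟩, ?_, ?_⟩, ?_⟩
  · rintro a ⟨ha, ha2⟩ b ⟨hb, hb2⟩
    refine ⟨fun x hx => ha _ (hb _ ?_), fun x hx => hb2 _ (ha2 _ ?_)⟩
    · rw [mul_assoc, hx]
    · rw [← mul_assoc, hx]
  · intro h
    obtain ⟨n, U, hU, -⟩ := hud
    obtain ⟨x, -, hx⟩ := (Submodule.ne_bot_iff _).1 (hU 0).1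
    exact hx (h.1 x (mul_zero x))
  · intro s hs r
    obtain ⟨c, hc, hc2⟩ := exists_lReg_of_ess hud huni (ess_comap (ess_of_lReg hud hs.1) r)
    obtain ⟨r', hr'⟩ := hc
    exact ⟨c, lReg_sub_reg hud huni hc2, r', hr'.symm⟩

theorem semisimple_of_loc {Q : Type u} [Ring Q] (f : R →+* Q) (hf : IsLeftLoc (reg R) f)
    (hess : ∀ I : Submodule R R, EssIdeal I → ∃ c ∈ I, c ∈ reg R) : IsSemisimpleRing Q := by
  obtain ⟨hu, hfrac, hker⟩ := hf
  have hinj : ∀ r, f r = 0 → r = 0 := by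
    intro r hr
    obtain ⟨s, hs, h⟩ := (hker r).1 hr
    exact hs.2 r h
  have htop : ∀ N : Submodule Q Q, EssIdeal N → N = ⊤ := by
    intro N hN
    let I : Submodule R R :=
      { carrier := {x | f x ∈ N}
        add_mem' := fun {a b} ha hb => by
          simp only [Set.mem_setOf_eq, map_add] at *
          exact N.add_mem ha hb
        zero_mem' := by simp
        smul_mem' := fun r x hx => by
          simp only [Set.mem_setOf_eq, smul_eq_mul, map_mul] at *
          exact N.smul_mem _ hx }
    have hI : EssIdeal I := by
      intro J hJ
      obtain ⟨j, hj, hj0⟩ := (Submodule.ne_bot_iff _).1 hJ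
      have hfj : f j ≠ 0 := fun h => hj0 (hinj _ h)
      obtain ⟨y, hy, hy2, hy0⟩ := exists_of_inf_ne_bot (hN _ (span_ne_bot hfj))
      obtain ⟨q, rfl⟩ := Submodule.mem_span_singleton.1 hy2
      obtain ⟨s, hs, r, hr⟩ := hfrac q
      have e : f (r * j) = f s * (q • f j) := by
        rw [map_mul, ← hr, smul_eq_mul, mul_assoc]
      refine inf_ne_bot_of (x := r * j) ?_ (J.smul_mem r hj) ?_
      · change f (r * j) ∈ N
        rw [e]
        exact N.smul_mem _ hy
      · intro h
        rw [h, map_zero] at e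
        exact hy0 ((hu s hs).mul_right_eq_zero.1 e.symm)
    obtain ⟨c, hc, hc2⟩ := hess I hI
    exact Ideal.eq_top_of_isUnit_mem N hc (hu c hc2)
  have : ComplementedLattice (Submodule Q Q) := by
    constructor
    intro I
    obtain ⟨K, -, hK⟩ := zorn_le_nonempty₀ {K : Submodule Q Q | Disjoint I K} (by
      intro C hC hchain y hy
      refine ⟨sSup C, ?_, fun z hz => le_sSup hz⟩
      rw [Set.mem_setOf_eq, hchain.directedOn.disjoint_sSup_right]
      exact fun b hb => hC hb) ⊥ disjoint_bot_right
    refine ⟨K, hK.prop, ?_⟩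
    rw [codisjoint_iff]
    refine htop _ fun L hL h => hL ?_
    have h1 : Disjoint I (K ⊔ L) := hK.prop.disjoint_sup_right_of_disjoint_sup_left
      (disjoint_iff.2 h)
    have h2 : L ≤ K := le_sup_right.trans (hK.le_of_ge h1 le_sup_left)
    rw [eq_bot_iff, ← h]
    exact le_inf (h2.trans le_sup_right) le_rfl
  exact (isSemisimpleModule_iff Q Q).2 this

theorem exists_loc (h : IsLeftOre (reg R)) :
    ∃ (Q : Type u) (_ : Ring Q) (f : R →+* Q), IsLeftLoc (reg R) f := by
  classical
  let S : Submonoid R :=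
    { carrier := reg R
      one_mem' := h.1.1
      mul_mem' := fun {a b} ha hb => h.1.2.1 a ha b hb }
  have hore : ∀ (r : R) (s : S), ∃ p : R × S, (p.2 : R) * r = p.1 * s := by
    intro r s
    obtain ⟨s', hs', r', e⟩ := h.2 s s.2 r
    exact ⟨(r', ⟨s', hs'⟩), e⟩
  choose p hp using hore
  letI : OreLocalization.OreSet S :=
    { ore_right_cancel := fun r₁ r₂ s e => ⟨1, by
        have : (r₁ - r₂) * (s : R) = 0 := by rw [sub_mul, e, sub_self]
        rw [sub_eq_zero.1 (s.2.1 _ this)]⟩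
      oreNum := fun r s => (p r s).1
      oreDenom := fun r s => (p r s).2
      ore_eq := hp }
  let f : R →+* OreLocalization S R :=
    { (OreLocalization.numeratorHom : R →* OreLocalization S R) with
      map_zero' := by
        exact (OreLocalization.zero_def).symm
      map_add' := fun x y => by
        exact (OreLocalization.add_oreDiv).symm }
  refine ⟨OreLocalization S R, inferInstance, f, ?_, ?_, ?_⟩
  · intro s hs
    exact OreLocalization.numerator_isUnit (⟨s, hs⟩ : S)
  · intro q
    induction q using OreLocalization.ind with
    | _ r s =>
    exact ⟨s, s.2, r, OreLocalization.mul_cancel⟩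
  · intro r
    constructor
    · intro hr
      have h0 : f r = f 0 := by rw [hr, map_zero]
      have hS : S ≤ nonZeroDivisorsLeft R := fun s hs x hx => hs.2 x hx
      exact ⟨1, h.1.1, by rw [OreLocalization.numeratorHom_inj hS h0, mul_zero]⟩
    · rintro ⟨s, hs, hsr⟩
      rw [hs.2 r hsr, map_zero]

end Aux

/-- Corollary a26Feb15: a semiprime right Noetherian ring `R` with `udim(_R R) < ∞`
and `'C_U ≠ ∅` for all uniform left ideals `U` has a semisimple Artinian classical
left quotient ring `Q_{l,cl}(R)`. -/
theorem classicalLeftQuotient_semisimple_of_rightNoetherian {R : Type u} [Ring R]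
    (hsp : SemiprimeRing R)
    (hnoeth : AccOnSets {I : Set R | IsRightIdealSet I})
    (hud : FinUdim R)
    (huni : ∀ U : Submodule R R, UniformIdeal U → (lRegIn U).Nonempty) :
    IsLeftOre (reg R) ∧
    ∃ (Q : Type u) (_ : Ring Q) (f : R →+* Q),
      IsLeftLoc (reg R) f ∧ IsSemisimpleRing Q := by
  have hO := leftOre hud huni
  obtain ⟨Q, iQ, f, hf⟩ := exists_loc hO
  refine ⟨hO, Q, iQ, f, hf, semisimple_of_loc f hf fun I hI => ?_⟩
  obtain ⟨c, hc, hc2⟩ := exists_lReg_of_ess hud huni hI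
  exact ⟨c, hc, lReg_sub_reg hud huni hc2⟩

end Bavula
end
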